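/- (Lemma A.3, quantum-plane form.) Let e be a positive integer, β, β' integers, and ε ∈ {+1, −1}. In the completed quantum plane A_{2e} (so Y₂Y₁ = v^{4e}·Y₁Y₂), both of the following identities of infinite ordered products hold: (i) Ψ_{v^e}(v^{β'}·Y₂) · →∏_{p≥0} Ψ_{v^{2e}}(v^{β+2pβ'+2pεe}·y^{(1,2p)}) = Ψ_{v^{2e}}(v^{β}·Y₁) · (→∏_{p≥1} Ψ_{v^{e}}(v^{β+pβ'+(p−1)εe}·y^{(1,p)})) · Ψ_{v^{e}}(v^{β'}·Y₂); and (ii) (←∏_{p≥0} Ψ_{v^{2e}}(v^{2pβ+β'+2pεe}·y^{(2p,1)})) · Ψ_{v^{e}}(v^{β}·Y₁) = Ψ_{v^{e}}(v^{β}·Y₁) · (←∏_{p≥1} Ψ_{v^{e}}(v^{pβ+β'+(p−1)εe}·y^{(p,1)})) · Ψ_{v^{2e}}(v^{β'}·Y₂), where each infinite ordered product is the coefficientwise limit of its partial ordered products. -/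

import Mathlib

noncomputable section

open Filter

abbrev K : Type := RatFunc ℚ

/-- The indeterminate generator `v` of `K = ℚ(v)`. -/
def v : K := RatFunc.X

/-- The completed quantum plane: formal series `Σ c_{m,n}·Y₁^m Y₂^n`, encoded as
coefficient functions `ℕ × ℕ → K`. -/
abbrev QP : Type := (ℕ × ℕ) → K

/-- The twisted product of the completed quantum plane `A_γ`:
`(Y₁^a Y₂^b)·(Y₁^{a'} Y₂^{b'}) = v^{2γba'}·Y₁^{a+a'} Y₂^{b+b'}`, extended bilinearly and
continuously for the coefficientwise topology. -/
def qmul (γ : ℕ) (F G : QP) : QP := fun p =>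
  ∑ a ∈ Finset.range (p.1 + 1), ∑ b ∈ Finset.range (p.2 + 1),
    v ^ (2 * γ * b * (p.1 - a)) * F (a, b) * G (p.1 - a, p.2 - b)

/-- The multiplicative unit of the completed quantum plane. -/
def qone : QP := fun p => if p = (0, 0) then 1 else 0

/-- Powers in the completed quantum plane. -/
def qpow (γ : ℕ) (Z : QP) : ℕ → QP
  | 0 => qone
  | k + 1 => qmul γ Z (qpow γ Z k)

/-- The element `v^β · y^{(m,n)} = v^{β + γmn} · Y₁^m Y₂^n` of `A_γ`
(`y^{(m,n)} := v^{γmn}·Y₁^m Y₂^n` is the normalized quantum monomial). -/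
def qy (γ : ℕ) (β : ℤ) (m n : ℕ) : QP := fun p =>
  if p = (m, n) then v ^ (β + (γ : ℤ) * (m : ℤ) * (n : ℤ)) else 0

/-- The series `Σ_{j≥1} ((−1)^{j+1}/(j·(w^j − w^{−j})))·Z^j` (for `Z` with zero
constant term, the coefficient at `(m,n)` only involves `j ≤ m + n`). -/
def qarg (γ : ℕ) (w : K) (Z : QP) : QP := fun r =>
  ∑ j ∈ Finset.Icc 1 (r.1 + r.2),
    ((-1 : K) ^ (j + 1) / ((j : K) * (w ^ j - w⁻¹ ^ j))) * qpow γ Z j r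

/-- The quantum dilogarithm `Ψ_w(Z) = exp(Σ_{j≥1} ((−1)^{j+1}/(j(w^j − w^{−j})))·Z^j)`
in `A_γ`, for `Z` with zero constant term. -/
def qPsi (γ : ℕ) (w : K) (Z : QP) : QP := fun p =>
  ∑ k ∈ Finset.range (p.1 + p.2 + 1),
    ((Nat.factorial k : K)⁻¹) * qpow γ (qarg γ w Z) k p

/-- The ordered product `→∏_{p=a..b} g_p = g_a g_{a+1} ⋯ g_b` in `A_γ`. -/
def qprodR (γ : ℕ) (g : ℕ → QP) (a b : ℕ) : QP :=
  ((List.range' a (b + 1 - a)).map g).foldr (qmul γ) qone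

/-- The ordered product `←∏_{p=a..b} g_p = g_b ⋯ g_{a+1} g_a` in `A_γ`. -/
def qprodL (γ : ℕ) (g : ℕ → QP) (a b : ℕ) : QP :=
  ((List.range' a (b + 1 - a)).reverse.map g).foldr (qmul γ) qone

section Series

open PowerSeries

variable {F : Type*} [Field F]

/-- The exponential `exp(L)` of a power series `L` with zero constant term. -/
noncomputable def expSeries (L : F⟦X⟧) : F⟦X⟧ :=
  PowerSeries.mk fun n => ∑ k ∈ Finset.range (n + 1), (Nat.factorial k : F)⁻¹ * coeff n (L ^ k)

theorem coeff_pow_eq_zero_of_lt {L : F⟦X⟧} (hL : constantCoeff L = 0) {n k : ℕ} (h : n < k) :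
    coeff n (L ^ k) = 0 :=
  X_pow_dvd_iff.1 (pow_dvd_pow_of_dvd (X_dvd_iff.2 hL) k) n h

theorem coeff_expSeries {L : F⟦X⟧} (hL : constantCoeff L = 0) {n N : ℕ} (h : n ≤ N) :
    coeff n (expSeries L) =
      ∑ k ∈ Finset.range (N + 1), (Nat.factorial k : F)⁻¹ * coeff n (L ^ k) := by
  rw [expSeries, coeff_mk]
  refine Finset.sum_subset (fun x hx => ?_) (fun x _ hx => ?_)
  · simp only [Finset.mem_range] at *
    omega
  · rw [coeff_pow_eq_zero_of_lt hL (by simpa using hx), mul_zero]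

theorem constantCoeff_expSeries (L : F⟦X⟧) : constantCoeff (expSeries L) = 1 := by
  rw [← coeff_zero_eq_constantCoeff_apply, expSeries, coeff_mk]
  simp

theorem rescale_expSeries (c : F) (L : F⟦X⟧) :
    rescale c (expSeries L) = expSeries (rescale c L) := by
  ext n
  simp only [expSeries, coeff_rescale, coeff_mk, ← map_pow, Finset.mul_sum]
  exact Finset.sum_congr rfl fun k _ => by ring

theorem derivative_expSeries [CharZero F] {L : F⟦X⟧} (hL : constantCoeff L = 0) :
    derivative F (expSeries L) = derivative F L * expSeries L := by
  ext n
  have h (k : ℕ) : (Nat.factorial (k + 1) : F)⁻¹ * coeff (n + 1) (L ^ (k + 1)) * (n + 1) =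
      coeff n (derivative F L * (C (Nat.factorial k : F)⁻¹ * L ^ k)) := by
    have hk : (k + 1 : F) ≠ 0 := by exact_mod_cast k.succ_ne_zero
    have hf : (Nat.factorial k : F) ≠ 0 := by exact_mod_cast k.factorial_ne_zero
    have h2 : derivative F (L ^ (k + 1)) = C (k + 1 : F) * (derivative F L * L ^ k) := by
      rw [derivative_pow]
      simp
      ring
    rw [mul_assoc, ← coeff_derivative, h2, coeff_C_mul, mul_left_comm (derivative F L), coeff_C_mul,
      Nat.factorial_succ]
    push_cast
    field_simp
  have h3 : coeff n (derivative F L * expSeries L) = coeff n (derivative F L *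
      ∑ k ∈ Finset.range (n + 1), C (Nat.factorial k : F)⁻¹ * L ^ k) := by
    rw [coeff_mul, coeff_mul]
    refine Finset.sum_congr rfl fun x hx => ?_
    rw [coeff_expSeries hL (N := n) (by have := Finset.HasAntidiagonal.mem_antidiagonal.1 hx; omega)]
    simp [map_sum]
  rw [coeff_derivative, coeff_expSeries hL le_rfl, Finset.sum_range_succ', h3, Finset.mul_sum,
    map_sum, add_mul, Finset.sum_mul, Finset.sum_congr rfl fun k _ => h k]
  simp [coeff_one]

theorem eq_of_derivative_eq_mul [CharZero F] {a f g : F⟦X⟧} (hf : derivative F f = a * f)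
    (hg : derivative F g = a * g) (h0 : constantCoeff f = constantCoeff g) : f = g := by
  ext n
  induction n using Nat.strong_induction_on with
  | _ n ih =>
    cases n with
    | zero => simpa using h0
    | succ n =>
      have h1 := congrArg (coeff n) hf
      have h2 := congrArg (coeff n) hg
      rw [coeff_derivative, coeff_mul] at h1 h2
      have hn : (n + 1 : F) ≠ 0 := by exact_mod_cast n.succ_ne_zero
      refine mul_right_cancel₀ hn (h1.trans (Eq.trans ?_ h2.symm))
      refine Finset.sum_congr rfl fun x hx => ?_
      rw [ih _ (by have := Finset.HasAntidiagonal.mem_antidiagonal.1 hx; omega)]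

/-- The logarithm `Σ_{j≥1} ((−1)^{j+1}/(j·(w^j − w^{−j})))·X^j` of the quantum dilogarithm. -/
noncomputable def logPsi (w : F) : F⟦X⟧ :=
  PowerSeries.mk fun j => (-1 : F) ^ (j + 1) / ((j : F) * (w ^ j - w⁻¹ ^ j))

/-- The quantum dilogarithm as a power series in one variable. -/
noncomputable def psiSeries (w : F) : F⟦X⟧ := expSeries (logPsi w)

theorem constantCoeff_logPsi (w : F) : constantCoeff (logPsi w) = 0 := by
  rw [← coeff_zero_eq_constantCoeff_apply, logPsi, coeff_mk]
  simp

theorem pow_sub_inv_pow_ne_zero {w : F} (h0 : w ≠ 0) (hw : ∀ n : ℕ, n ≠ 0 → w ^ n ≠ 1) {j : ℕ}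
    (hj : j ≠ 0) : w ^ j - w⁻¹ ^ j ≠ 0 := by
  intro h
  refine hw (j + j) (by omega) ?_
  rw [pow_add]
  nth_rewrite 1 [sub_eq_zero.1 h]
  rw [← mul_pow, inv_mul_cancel₀ h0, one_pow]

theorem derivative_rescale_logPsi [CharZero F] {w : F} (h0 : w ≠ 0)
    (hw : ∀ n : ℕ, n ≠ 0 → w ^ n ≠ 1) :
    derivative F (rescale (w ^ 2) (logPsi w)) =
      derivative F (logPsi w) + PowerSeries.mk fun n => (-1) ^ n * w ^ (n + 1) := by
  ext n
  have hd := pow_sub_inv_pow_ne_zero h0 hw n.succ_ne_zero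
  have hn : (n + 1 : F) ≠ 0 := by exact_mod_cast n.succ_ne_zero
  have hm : (w ^ 2) ^ (n + 1) - 1 = w ^ (n + 1) * (w ^ (n + 1) - w⁻¹ ^ (n + 1)) := by
    rw [mul_sub, ← mul_pow w w⁻¹, mul_inv_cancel₀ h0, one_pow]
    ring
  rw [map_add, coeff_derivative, coeff_derivative, coeff_rescale, coeff_mk, logPsi, coeff_mk,
    ← sub_eq_iff_eq_add']
  push_cast
  set d := w ^ (n + 1) - w⁻¹ ^ (n + 1)
  calc _ = ((w ^ 2) ^ (n + 1) - 1) * ((-1) ^ (n + 1 + 1) / ((n + 1) * d) * (n + 1)) := by ring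
    _ = _ := by
      rw [hm]
      field_simp
      ring

theorem rescale_psiSeries [CharZero F] {w : F} (h0 : w ≠ 0) (hw : ∀ n : ℕ, n ≠ 0 → w ^ n ≠ 1) :
    rescale (w ^ 2) (psiSeries w) = (1 + C w * X) * psiSeries w := by
  have hL : constantCoeff (rescale (w ^ 2) (logPsi w)) = 0 := by
    rw [← coeff_zero_eq_constantCoeff_apply, coeff_rescale, coeff_zero_eq_constantCoeff_apply,
      constantCoeff_logPsi, mul_zero]
  have hg : (1 + C w * X) * (PowerSeries.mk fun n => (-1) ^ n * w ^ (n + 1)) = C w := by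
    ext n
    rw [add_mul, one_mul, mul_assoc, map_add, coeff_C_mul, coeff_mk]
    cases n with
    | zero => simp
    | succ n =>
      rw [coeff_succ_X_mul, coeff_mk, coeff_C, if_neg n.succ_ne_zero]
      ring
  rw [psiSeries, rescale_expSeries]
  refine eq_of_derivative_eq_mul (derivative_expSeries hL) ?_ ?_
  · rw [derivative_rescale_logPsi h0 hw, Derivation.leibniz, derivative_expSeries
      (constantCoeff_logPsi w)]
    simp only [map_add, Derivation.leibniz, derivative_one, derivative_C, derivative_X,
      smul_eq_mul, mul_zero, add_zero, zero_add, mul_one]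
    linear_combination (- expSeries (logPsi w)) * hg
  · simp [constantCoeff_expSeries]

theorem coeff_psiSeries_succ [CharZero F] {w : F} (h0 : w ≠ 0)
    (hw : ∀ n : ℕ, n ≠ 0 → w ^ n ≠ 1) (n : ℕ) :
    ((w ^ 2) ^ (n + 1) - 1) * coeff (n + 1) (psiSeries w) = w * coeff n (psiSeries w) := by
  have h := congrArg (coeff (n + 1)) (rescale_psiSeries h0 hw)
  rw [coeff_rescale, add_mul, one_mul, mul_assoc, map_add, coeff_C_mul, coeff_succ_X_mul] at h
  linear_combination h

theorem eq_of_rescale_eq {c w : F} (hc : ∀ n : ℕ, n ≠ 0 → c ^ n ≠ 1) {f g : F⟦X⟧}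
    (hf : rescale c f = (1 + C w * X) * f) (hg : rescale c g = (1 + C w * X) * g)
    (h : constantCoeff f = constantCoeff g) : f = g := by
  ext n
  induction n with
  | zero => simpa using h
  | succ n ih =>
    have h1 := congrArg (coeff (n + 1)) hf
    have h2 := congrArg (coeff (n + 1)) hg
    rw [coeff_rescale, add_mul, one_mul, mul_assoc, map_add, coeff_C_mul, coeff_succ_X_mul] at h1 h2
    refine mul_left_cancel₀ (sub_ne_zero.2 (hc (n + 1) n.succ_ne_zero)) ?_
    linear_combination h1 - h2 + w * ih

/-- The quantum dilogarithm at `w` factors into two quantum dilogarithms at `w ^ 2`. -/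
theorem psiSeries_eq_mul [CharZero F] {w : F} (h0 : w ≠ 0) (hw : ∀ n : ℕ, n ≠ 0 → w ^ n ≠ 1) :
    psiSeries w = rescale w⁻¹ (psiSeries (w ^ 2)) * rescale w (psiSeries (w ^ 2)) := by
  have hw2 : ∀ n : ℕ, n ≠ 0 → (w ^ 2) ^ n ≠ 1 := fun n hn => by
    rw [← pow_mul]
    exact hw _ (by omega)
  have hc (c : F) : constantCoeff (rescale c (psiSeries (w ^ 2))) = 1 := by
    rw [psiSeries, rescale_expSeries, constantCoeff_expSeries]
  refine eq_of_rescale_eq hw2 (rescale_psiSeries h0 hw) ?_ ?_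
  · have h1 : rescale (w ^ 2) (rescale w (psiSeries (w ^ 2))) =
        (1 + C w * X) * rescale w⁻¹ (psiSeries (w ^ 2)) := by
      have h := congrArg (rescale w⁻¹) (rescale_psiSeries (pow_ne_zero 2 h0) hw2)
      rw [rescale_rescale, map_mul, map_add, map_mul, map_one, rescale_X] at h
      rw [rescale_rescale]
      have hC : rescale w⁻¹ (C (w ^ 2)) = C (w ^ 2) := by
        ext n
        rw [coeff_rescale, coeff_C]
        split_ifs with hn
        · simp [hn]
        · simp
      have e1 : w ^ 2 * w⁻¹ = w := by field_simp
      have e2 : w * w ^ 2 = (w ^ 2) ^ 2 * w⁻¹ := by field_simp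
      rw [e2]
      rw [hC, ← mul_assoc, ← map_mul, e1] at h
      exact h
    rw [map_mul, h1, rescale_rescale, show w⁻¹ * w ^ 2 = w by field_simp]
    ring
  · rw [map_mul, hc, hc, psiSeries, constantCoeff_expSeries, one_mul]

/-- A form of the `q`-Vandermonde identity, for the coefficients of the quantum dilogarithm. -/
theorem pentagon_coeff {q : F} (hq : ∀ n : ℕ, n ≠ 0 → (q ^ 2) ^ n ≠ 1) {a : ℕ → F}
    (h0 : a 0 = 1) (ha : ∀ n, ((q ^ 2) ^ (n + 1) - 1) * a (n + 1) = q * a n) (m n : ℕ) :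
    (q ^ 2) ^ (m * n) * a m * a n = ∑ x ∈ Finset.HasAntidiagonal.antidiagonal n,
      q ^ (x.2 ^ 2) * a x.1 * a x.2 * if x.2 ≤ m then a (m - x.2) else 0 := by
  have hg (j : ℕ) : (q ^ 2) ^ j * (q * if j + 1 ≤ m then a (m - (j + 1)) else 0) =
      ((q ^ 2) ^ m - (q ^ 2) ^ j) * if j ≤ m then a (m - j) else 0 := by
    rcases lt_trichotomy j m with h | h | h
    · obtain ⟨k, rfl⟩ := Nat.exists_eq_add_of_lt h
      rw [if_pos (by omega), if_pos (by omega), show j + k + 1 - (j + 1) = k by omega,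
        show j + k + 1 - j = k + 1 by omega]
      linear_combination -(q ^ 2) ^ j * ha k
    · subst h
      simp
    · rw [if_neg (by omega), if_neg (by omega)]
      simp
  induction n with
  | zero => simp [h0]
  | succ n ih =>
    refine mul_left_cancel₀ (sub_ne_zero.2 (hq (n + 1) n.succ_ne_zero)) ?_
    set g : ℕ → F := fun j => if j ≤ m then a (m - j) else 0 with hgdef
    have hsplit : ((q ^ 2) ^ (n + 1) - 1) * ∑ x ∈ Finset.HasAntidiagonal.antidiagonal (n + 1),
        q ^ (x.2 ^ 2) * a x.1 * a x.2 * g x.2 =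
        ∑ x ∈ Finset.HasAntidiagonal.antidiagonal (n + 1),
          q ^ (x.2 ^ 2) * (((q ^ 2) ^ x.1 - 1) * a x.1) * (q ^ 2) ^ x.2 * a x.2 * g x.2 +
        ∑ x ∈ Finset.HasAntidiagonal.antidiagonal (n + 1),
          q ^ (x.2 ^ 2) * a x.1 * (((q ^ 2) ^ x.2 - 1) * a x.2) * g x.2 := by
      rw [Finset.mul_sum, ← Finset.sum_add_distrib]
      refine Finset.sum_congr rfl fun x hx => ?_
      rw [← Finset.HasAntidiagonal.mem_antidiagonal.1 hx]
      ring
    have hrw : ∑ x ∈ Finset.HasAntidiagonal.antidiagonal (n + 1),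
          q ^ (x.2 ^ 2) * (((q ^ 2) ^ x.1 - 1) * a x.1) * (q ^ 2) ^ x.2 * a x.2 * g x.2 +
        ∑ x ∈ Finset.HasAntidiagonal.antidiagonal (n + 1),
          q ^ (x.2 ^ 2) * a x.1 * (((q ^ 2) ^ x.2 - 1) * a x.2) * g x.2 =
        q * (q ^ 2) ^ m * ∑ x ∈ Finset.HasAntidiagonal.antidiagonal n,
          q ^ (x.2 ^ 2) * a x.1 * a x.2 * g x.2 := by
      rw [Finset.Nat.sum_antidiagonal_succ, Finset.Nat.sum_antidiagonal_succ']
      simp only [pow_zero, sub_self, zero_mul, mul_zero, zero_add, ha]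
      rw [Finset.mul_sum, ← Finset.sum_add_distrib]
      refine Finset.sum_congr rfl fun x _ => ?_
      linear_combination (q ^ (x.2 ^ 2) * q * a x.1 * a x.2) * hg x.2
    rw [hsplit, hrw, ← ih]
    linear_combination (q ^ 2) ^ (m * (n + 1)) * a m * ha n

end Series

theorem v_ne_zero : v ≠ 0 := RatFunc.X_ne_zero

theorem v_pow_ne_one {n : ℕ} (hn : n ≠ 0) : v ^ n ≠ 1 := by
  intro h
  rw [v, ← RatFunc.algebraMap_X, ← map_pow, ← map_one (algebraMap (Polynomial ℚ) (RatFunc ℚ))] at h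
  have h1 := congrArg Polynomial.natDegree (RatFunc.algebraMap_injective ℚ h)
  rw [Polynomial.natDegree_X_pow, Polynomial.natDegree_one] at h1
  exact hn h1

section QuantumPlane

open Finset.HasAntidiagonal

theorem qmul_apply (γ : ℕ) (F G : QP) (m n : ℕ) :
    qmul γ F G (m, n) = ∑ x ∈ antidiagonal m, ∑ y ∈ antidiagonal n,
      v ^ (2 * γ * y.1 * x.2) * F (x.1, y.1) * G (x.2, y.2) := by
  rw [qmul, Finset.Nat.sum_antidiagonal_eq_sum_range_succ_mk]
  refine Finset.sum_congr rfl fun a _ => ?_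
  rw [Finset.Nat.sum_antidiagonal_eq_sum_range_succ_mk]

theorem sum_antidiagonal_assoc {M : Type*} [AddCommMonoid M] (f : ℕ → ℕ → ℕ → M) (n : ℕ) :
    ∑ x ∈ antidiagonal n, ∑ y ∈ antidiagonal x.1, f y.1 y.2 x.2 =
      ∑ x ∈ antidiagonal n, ∑ y ∈ antidiagonal x.2, f x.1 y.1 y.2 := by
  simp only [Finset.sum_sigma']
  refine Finset.sum_nbij' (fun p : (_ : ℕ × ℕ) × ℕ × ℕ =>
      ⟨(p.2.1, p.2.2 + p.1.2), (p.2.2, p.1.2)⟩)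
    (fun p : (_ : ℕ × ℕ) × ℕ × ℕ => ⟨(p.1.1 + p.2.1, p.2.2), (p.1.1, p.2.1)⟩) ?_ ?_ ?_ ?_ ?_ <;>
  rintro ⟨⟨i, j⟩, ⟨k, l⟩⟩ h <;>
  simp only [Finset.mem_sigma, mem_antidiagonal] at h ⊢ <;>
  obtain ⟨h1, h2⟩ := h
  · exact ⟨by omega, trivial⟩
  · exact ⟨by omega, trivial⟩
  · rw [h2]
  · rw [h2]

theorem qmul_assoc (γ : ℕ) (F G H : QP) : qmul γ (qmul γ F G) H = qmul γ F (qmul γ G H) := by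
  funext ⟨m, n⟩
  let g (a b c d e f : ℕ) : K :=
    v ^ (2 * γ * ((d + e) * c + d * b)) * F (a, d) * G (b, e) * H (c, f)
  have hl : qmul γ (qmul γ F G) H (m, n) = ∑ x ∈ antidiagonal m, ∑ x' ∈ antidiagonal x.1,
      ∑ y ∈ antidiagonal n, ∑ y' ∈ antidiagonal y.1, g x'.1 x'.2 x.2 y'.1 y'.2 y.2 := by
    rw [qmul_apply]
    refine Finset.sum_congr rfl fun x _ => ?_
    rw [Finset.sum_comm]
    refine Finset.sum_congr rfl fun y _ => ?_
    rw [qmul_apply, Finset.mul_sum, Finset.sum_mul]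
    refine Finset.sum_congr rfl fun x' _ => ?_
    rw [Finset.mul_sum, Finset.sum_mul]
    refine Finset.sum_congr rfl fun y' hy' => ?_
    rw [← mem_antidiagonal.1 hy']
    simp only [g]
    ring
  have hr : qmul γ F (qmul γ G H) (m, n) = ∑ x ∈ antidiagonal m, ∑ x' ∈ antidiagonal x.2,
      ∑ y ∈ antidiagonal n, ∑ y' ∈ antidiagonal y.2, g x.1 x'.1 x'.2 y.1 y'.1 y'.2 := by
    rw [qmul_apply]
    refine Finset.sum_congr rfl fun x _ => ?_
    rw [Finset.sum_comm]
    refine Finset.sum_congr rfl fun y _ => ?_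
    rw [qmul_apply, Finset.mul_sum]
    refine Finset.sum_congr rfl fun x' hx' => ?_
    rw [Finset.mul_sum]
    refine Finset.sum_congr rfl fun y' _ => ?_
    rw [← mem_antidiagonal.1 hx']
    simp only [g]
    ring
  rw [hl, hr, ← sum_antidiagonal_assoc fun a b c => ∑ y ∈ antidiagonal n,
    ∑ y' ∈ antidiagonal y.2, g a b c y.1 y'.1 y'.2]
  refine Finset.sum_congr rfl fun x _ => Finset.sum_congr rfl fun x' _ => ?_
  exact sum_antidiagonal_assoc (fun d e f => g x'.1 x'.2 x.2 d e f) n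

theorem qone_qmul (γ : ℕ) (F : QP) : qmul γ qone F = F := by
  funext ⟨m, n⟩
  rw [qmul_apply, Finset.sum_eq_single_of_mem (0, m) (by simp),
    Finset.sum_eq_single_of_mem (0, n) (by simp)]
  · simp [qone]
  · rintro ⟨a, b⟩ h1 h2
    have : a ≠ 0 := by
      rintro rfl
      simp_all
    simp [qone, this]
  · rintro ⟨a, b⟩ h1 h2
    have : a ≠ 0 := by
      rintro rfl
      simp_all
    simp [qone, this]

/-- The anti-automorphism of the quantum plane exchanging the two generators. -/
def qswap (F : QP) : QP := fun p => F p.swap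

theorem qmul_qswap (γ : ℕ) (F G : QP) : qmul γ (qswap F) (qswap G) = qswap (qmul γ G F) := by
  funext ⟨m, n⟩
  rw [qswap, Prod.swap_prod_mk, qmul_apply, qmul_apply, Finset.sum_comm,
    ← Finset.Nat.sum_antidiagonal_swap]
  refine Finset.sum_congr rfl fun x _ => ?_
  rw [← Finset.Nat.sum_antidiagonal_swap]
  refine Finset.sum_congr rfl fun y _ => ?_
  simp only [qswap, Prod.swap_prod_mk, Prod.fst_swap, Prod.snd_swap]
  ring

theorem qswap_qone : qswap qone = qone := by
  funext ⟨m, n⟩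
  simp [qswap, qone, and_comm]

theorem qmul_qone (γ : ℕ) (F : QP) : qmul γ F qone = F := by
  have h := congrArg qswap (qone_qmul γ (qswap F))
  rwa [← qmul_qswap, qswap_qone] at h

theorem qpow_succ' (γ : ℕ) (Z : QP) (k : ℕ) : qpow γ Z (k + 1) = qmul γ (qpow γ Z k) Z := by
  induction k with
  | zero => simp only [qpow, qone_qmul, qmul_qone]
  | succ k ih =>
    calc qpow γ Z (k + 1 + 1) = qmul γ Z (qmul γ (qpow γ Z k) Z) := by rw [← ih, qpow]
      _ = qmul γ (qpow γ Z (k + 1)) Z := by rw [← qmul_assoc, qpow]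

theorem qpow_qswap (γ : ℕ) (Z : QP) (k : ℕ) : qpow γ (qswap Z) k = qswap (qpow γ Z k) := by
  induction k with
  | zero => exact qswap_qone.symm
  | succ k ih => rw [qpow_succ', ih, qmul_qswap, qpow]

theorem qarg_qswap (γ : ℕ) (w : K) (Z : QP) : qarg γ w (qswap Z) = qswap (qarg γ w Z) := by
  funext p
  simp only [qarg, qswap, qpow_qswap, Prod.fst_swap, Prod.snd_swap, add_comm]

theorem qPsi_qswap (γ : ℕ) (w : K) (Z : QP) : qPsi γ w (qswap Z) = qswap (qPsi γ w Z) := by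
  funext p
  rw [qPsi, qarg_qswap]
  simp only [qPsi, qswap, qpow_qswap, Prod.fst_swap, Prod.snd_swap, add_comm]

theorem qy_eq_qswap (γ : ℕ) (β : ℤ) (m n : ℕ) : qy γ β m n = qswap (qy γ β n m) := by
  funext ⟨a, b⟩
  simp only [qy, qswap, Prod.swap_prod_mk, Prod.mk.injEq, and_comm (a := a = m),
    mul_right_comm (γ : ℤ) (m : ℤ)]

/-- The ordered product `g_a ⋯ g_{a+n-1}·T`. -/
def qprodMul (γ : ℕ) (g : ℕ → QP) (a n : ℕ) (T : QP) : QP :=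
  ((List.range' a n).map g).foldr (qmul γ) T

theorem foldr_qmul (γ : ℕ) (l : List QP) (T : QP) :
    l.foldr (qmul γ) T = qmul γ (l.foldr (qmul γ) qone) T := by
  induction l with
  | nil => exact (qone_qmul γ T).symm
  | cons a l ih => rw [List.foldr_cons, List.foldr_cons, ih, qmul_assoc]

theorem qprodMul_succ (γ : ℕ) (g : ℕ → QP) (a n : ℕ) (T : QP) :
    qprodMul γ g a (n + 1) T = qprodMul γ g a n (qmul γ (g (a + n)) T) := by
  rw [qprodMul, List.range'_1_concat, List.map_append, List.foldr_append]
  rfl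

theorem qprodL_qswap (γ : ℕ) (g : ℕ → QP) (a b : ℕ) :
    qprodL γ (fun p => qswap (g p)) a b = qswap (qprodR γ g a b) := by
  rw [qprodL, qprodR]
  induction List.range' a (b + 1 - a) with
  | nil => exact qswap_qone.symm
  | cons x l ih =>
    rw [List.reverse_cons, List.map_append, List.foldr_append, foldr_qmul, ih]
    simp only [List.map_cons, List.map_nil, List.foldr_cons, List.foldr_nil, qmul_qone]
    rw [qmul_qswap]

end QuantumPlane

section Embedding

open PowerSeries Finset.HasAntidiagonal

/-- The element of the quantum plane whose coefficient at `p` is `u p` times the coefficient of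
`f` at `ℓ p`. -/
def ofSeries (ℓ : ℕ × ℕ → ℕ) (u : ℕ × ℕ → K) (f : K⟦X⟧) : QP := fun p => u p * coeff (ℓ p) f

/-- The map `ofSeries ℓ u` is multiplicative, and `ℓ` is bounded by the total degree. -/
structure IsSeriesEmbedding (γ : ℕ) (ℓ : ℕ × ℕ → ℕ) (u : ℕ × ℕ → K) : Prop where
  le : ∀ p, ℓ p ≤ p.1 + p.2
  one : ofSeries ℓ u 1 = qone
  mul : ∀ f g, qmul γ (ofSeries ℓ u f) (ofSeries ℓ u g) = ofSeries ℓ u (f * g)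

namespace IsSeriesEmbedding

variable {γ : ℕ} {ℓ : ℕ × ℕ → ℕ} {u : ℕ × ℕ → K}

theorem qpow_eq (h : IsSeriesEmbedding γ ℓ u) (f : K⟦X⟧) (k : ℕ) :
    qpow γ (ofSeries ℓ u f) k = ofSeries ℓ u (f ^ k) := by
  induction k with
  | zero => rw [pow_zero, h.one, qpow]
  | succ k ih => rw [qpow, ih, h.mul, pow_succ']

theorem qarg_eq (h : IsSeriesEmbedding γ ℓ u) (w c : K) :
    qarg γ w (ofSeries ℓ u (C c * X)) = ofSeries ℓ u (rescale c (logPsi w)) := by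
  funext p
  simp only [qarg, h.qpow_eq, ofSeries, mul_pow, ← map_pow, coeff_C_mul, coeff_X_pow,
    coeff_rescale, mul_ite, mul_one, mul_zero, Finset.sum_ite_eq, logPsi, coeff_mk]
  split_ifs with hp
  · ring
  · have h0 : ℓ p = 0 := by
      have := h.le p
      rw [Finset.mem_Icc] at hp
      omega
    simp [h0]

theorem qPsi_eq (h : IsSeriesEmbedding γ ℓ u) (w c : K) :
    qPsi γ w (ofSeries ℓ u (C c * X)) = ofSeries ℓ u (rescale c (psiSeries w)) := by
  have hL : constantCoeff (rescale c (logPsi w)) = 0 := by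
    rw [← coeff_zero_eq_constantCoeff_apply, coeff_rescale, coeff_zero_eq_constantCoeff_apply,
      constantCoeff_logPsi, mul_zero]
  funext p
  rw [qPsi, h.qarg_eq, psiSeries, rescale_expSeries, ofSeries, coeff_expSeries hL (h.le p),
    Finset.mul_sum]
  refine Finset.sum_congr rfl fun k _ => ?_
  rw [h.qpow_eq, ofSeries]
  ring

end IsSeriesEmbedding

/-- The substitution of `y^{(1,k)}` into a power series. -/
def rowSeries (γ k : ℕ) (f : K⟦X⟧) : QP :=
  ofSeries Prod.fst (fun p => if p.2 = k * p.1 then v ^ (γ * k * p.1 ^ 2) else 0) f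

/-- The substitution of `Y₂` into a power series. -/
def colSeries (f : K⟦X⟧) : QP := ofSeries Prod.snd (fun p => if p.1 = 0 then 1 else 0) f

theorem rowSeries_qmul (γ k : ℕ) (f : K⟦X⟧) (G : QP) (m n : ℕ) :
    qmul γ (rowSeries γ k f) G (m, n) = ∑ x ∈ antidiagonal m, if k * x.1 ≤ n then
      v ^ (2 * γ * k * x.1 * x.2 + γ * k * x.1 ^ 2) * coeff x.1 f * G (x.2, n - k * x.1) else 0 := by
  rw [qmul_apply]
  refine Finset.sum_congr rfl fun x _ => ?_
  split_ifs with h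
  · rw [Finset.sum_eq_single_of_mem (k * x.1, n - k * x.1) (by simp [h])]
    · simp only [rowSeries, ofSeries, if_true]
      ring
    · rintro ⟨a, b⟩ h1 h2
      have : a ≠ k * x.1 := by
        rintro rfl
        apply h2
        rw [mem_antidiagonal] at h1
        simp only at h1
        rw [← h1, Nat.add_sub_cancel_left]
      simp [rowSeries, ofSeries, this]
  · refine Finset.sum_eq_zero fun y hy => ?_
    have : y.1 ≠ k * x.1 := by
      have := mem_antidiagonal.1 hy
      omega
    simp [rowSeries, ofSeries, this]

theorem colSeries_qmul (γ : ℕ) (f : K⟦X⟧) (G : QP) (m n : ℕ) :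
    qmul γ (colSeries f) G (m, n) =
      ∑ y ∈ antidiagonal n, v ^ (2 * γ * y.1 * m) * coeff y.1 f * G (m, y.2) := by
  rw [qmul_apply, Finset.sum_eq_single_of_mem (0, m) (by simp)]
  · simp [colSeries, ofSeries]
  · rintro ⟨a, b⟩ h1 h2
    have : a ≠ 0 := by
      rintro rfl
      simp_all
    simp [colSeries, ofSeries, this]

theorem isSeriesEmbedding_row (γ k : ℕ) : IsSeriesEmbedding γ Prod.fst
    (fun p => if p.2 = k * p.1 then v ^ (γ * k * p.1 ^ 2) else 0) where
  le p := Nat.le_add_right _ _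
  one := by
    funext ⟨m, n⟩
    by_cases h : m = 0
    · subst h
      simp [ofSeries, qone]
    · simp [ofSeries, qone, coeff_one, h]
  mul f g := by
    funext ⟨m, n⟩
    refine (rowSeries_qmul γ k f _ m n).trans ?_
    simp only [ofSeries, coeff_mul]
    by_cases h : n = k * m
    · rw [if_pos h, Finset.mul_sum]
      refine Finset.sum_congr rfl fun x hx => ?_
      have hx := mem_antidiagonal.1 hx
      have h1 : n = k * x.1 + k * x.2 := by rw [h, ← hx, mul_add]
      rw [if_pos (by omega), if_pos (by omega), ← hx]
      ring
    · rw [if_neg h, zero_mul]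
      refine Finset.sum_eq_zero fun x hx => ?_
      have hx := mem_antidiagonal.1 hx
      have h1 : n ≠ k * x.1 + k * x.2 := by rwa [← mul_add, hx]
      split_ifs
      · omega
      · simp
      · rfl

theorem isSeriesEmbedding_col (γ : ℕ) :
    IsSeriesEmbedding γ Prod.snd (fun p => if p.1 = 0 then 1 else 0) where
  le p := Nat.le_add_left _ _
  one := by
    funext ⟨m, n⟩
    by_cases h : m = 0
    · simp [ofSeries, qone, coeff_one, h]
    · simp [ofSeries, qone, h]
  mul f g := by
    funext ⟨m, n⟩
    refine (colSeries_qmul γ f _ m n).trans ?_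
    by_cases h : m = 0
    · simp [ofSeries, coeff_mul, h]
    · simp [ofSeries, h]

theorem qPsi_row (γ k : ℕ) (w : K) (β : ℤ) :
    qPsi γ w (qy γ β 1 k) = rowSeries γ k (rescale (v ^ β) (psiSeries w)) := by
  rw [rowSeries, ← (isSeriesEmbedding_row γ k).qPsi_eq]
  congr 1
  funext ⟨m, n⟩
  simp only [qy, ofSeries, coeff_C_mul, coeff_X, Prod.mk.injEq]
  by_cases h : m = 1
  · subst h
    by_cases hn : n = k
    · subst hn
      have h : v ^ (γ * n) = v ^ ((γ : ℤ) * n) := by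
        rw [← zpow_natCast]
        push_cast
        rfl
      simp [zpow_add₀ v_ne_zero, h, mul_comm]
    · simp [hn]
  · simp [h]

theorem qPsi_col (γ : ℕ) (w : K) (β : ℤ) :
    qPsi γ w (qy γ β 0 1) = colSeries (rescale (v ^ β) (psiSeries w)) := by
  rw [colSeries, ← (isSeriesEmbedding_col γ).qPsi_eq]
  congr 1
  funext ⟨m, n⟩
  simp only [qy, ofSeries, coeff_C_mul, coeff_X, Prod.mk.injEq]
  by_cases h : m = 0 <;> by_cases hn : n = 1 <;> simp [h, hn]

theorem rowSeries_mul (γ k : ℕ) (f g : K⟦X⟧) :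
    qmul γ (rowSeries γ k f) (rowSeries γ k g) = rowSeries γ k (f * g) :=
  (isSeriesEmbedding_row γ k).mul f g

theorem colSeries_mul (γ : ℕ) (f g : K⟦X⟧) :
    qmul γ (colSeries f) (colSeries g) = colSeries (f * g) :=
  (isSeriesEmbedding_col γ).mul f g

theorem colSeries_qmul_rowSeries (γ k : ℕ) (f g : K⟦X⟧) (m n : ℕ) :
    qmul γ (colSeries f) (rowSeries γ k g) (m, n) = if k * m ≤ n then
      v ^ (2 * γ * (n - k * m) * m + γ * k * m ^ 2) * coeff (n - k * m) f * coeff m g else 0 := by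
  rw [colSeries_qmul]
  split_ifs with h
  · rw [Finset.sum_eq_single_of_mem (n - k * m, k * m) (by simp [h])]
    · simp only [rowSeries, ofSeries, if_true]
      ring
    · rintro ⟨a, b⟩ h1 h2
      have : b ≠ k * m := by
        rintro rfl
        apply h2
        rw [mem_antidiagonal] at h1
        simp only at h1
        rw [← h1, Nat.add_sub_cancel]
      simp [rowSeries, ofSeries, this]
  · refine Finset.sum_eq_zero fun y hy => ?_
    have : y.2 ≠ k * m := by
      have := mem_antidiagonal.1 hy
      omega
    simp [rowSeries, ofSeries, this]

theorem rowSeries_qmul_colSeries (γ k : ℕ) (f g : K⟦X⟧) (m n : ℕ) :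
    qmul γ (rowSeries γ k f) (colSeries g) (m, n) = if k * m ≤ n then
      v ^ (γ * k * m ^ 2) * coeff m f * coeff (n - k * m) g else 0 := by
  rw [rowSeries_qmul, Finset.sum_eq_single_of_mem (m, 0) (by simp)]
  · simp [colSeries, ofSeries]
  · rintro ⟨a, b⟩ h1 h2
    have : b ≠ 0 := by
      rintro rfl
      simp_all
    simp [colSeries, ofSeries, this]

/-- The pentagon identity for the quantum dilogarithm. -/
theorem pentagon (γ : ℕ) (hγ : γ ≠ 0) (k : ℕ) (b c : K) :
    qmul γ (colSeries (rescale b (psiSeries (v ^ γ))))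
      (rowSeries γ k (rescale c (psiSeries (v ^ γ)))) =
    qmul γ (rowSeries γ k (rescale c (psiSeries (v ^ γ))))
      (qmul γ (rowSeries γ (k + 1) (rescale (c * b) (psiSeries (v ^ γ))))
        (colSeries (rescale b (psiSeries (v ^ γ))))) := by
  have hq1 : ∀ n : ℕ, n ≠ 0 → (v ^ γ) ^ n ≠ 1 := fun n hn => by
    rw [← pow_mul]
    exact v_pow_ne_one (mul_ne_zero hγ hn)
  have hq : ∀ n : ℕ, n ≠ 0 → ((v ^ γ) ^ 2) ^ n ≠ 1 := fun n hn => by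
    rw [← pow_mul]
    exact hq1 _ (by omega)
  have h0 : coeff 0 (psiSeries (v ^ γ)) = 1 := by
    rw [coeff_zero_eq_constantCoeff_apply, psiSeries, constantCoeff_expSeries]
  have hs := coeff_psiSeries_succ (pow_ne_zero γ v_ne_zero) hq1
  funext ⟨m, n⟩
  rw [colSeries_qmul_rowSeries, rowSeries_qmul]
  simp only [rowSeries_qmul_colSeries, coeff_rescale]
  split_ifs with h
  · obtain ⟨M, rfl⟩ := Nat.exists_eq_add_of_le h
    have hp := pentagon_coeff (a := fun j => coeff j (psiSeries (v ^ γ))) hq h0 hs M m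
    rw [Nat.add_sub_cancel_left]
    calc _ = v ^ (γ * k * m ^ 2) * b ^ M * c ^ m * (((v ^ γ) ^ 2) ^ (M * m) *
          coeff M (psiSeries (v ^ γ)) * coeff m (psiSeries (v ^ γ))) := by ring
      _ = _ := by
        rw [hp, Finset.mul_sum]
        refine Finset.sum_congr rfl fun x hx => ?_
        have hx := mem_antidiagonal.1 hx
        have hkm : k * m = k * x.1 + k * x.2 := by rw [← hx, mul_add]
        have hk1 : (k + 1) * x.2 = k * x.2 + x.2 := by ring
        have hk2 : k * x.1 ≤ k * m + M := by omega
        rw [if_pos hk2]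
        by_cases hM : x.2 ≤ M
        · obtain ⟨M', rfl⟩ := Nat.exists_eq_add_of_le hM
          rw [if_pos hM, if_pos (by omega), Nat.add_sub_cancel_left,
            show k * m + (x.2 + M') - k * x.1 - (k + 1) * x.2 = M' by omega, ← hx]
          ring
        · rw [if_neg hM, if_neg (by omega)]
          simp
  · refine (Finset.sum_eq_zero fun x hx => ?_).symm
    have hx := mem_antidiagonal.1 hx
    have hkm : k * m = k * x.1 + k * x.2 := by rw [← hx, mul_add]
    have hk1 : (k + 1) * x.2 = k * x.2 + x.2 := by ring
    split_ifs
    · omega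
    · simp
    · rfl

end Embedding

section Truncation

open PowerSeries

/-- Equality of the coefficients of degree at most `d` in `Y₂`. -/
def EqUpTo (d : ℕ) (F G : QP) : Prop := ∀ p : ℕ × ℕ, p.2 ≤ d → F p = G p

theorem EqUpTo.qmul {d : ℕ} {F F' G G' : QP} (hF : EqUpTo d F F') (hG : EqUpTo d G G') (γ : ℕ) :
    EqUpTo d (qmul γ F G) (qmul γ F' G') := by
  rintro ⟨m, n⟩ h
  rw [qmul_apply, qmul_apply]
  refine Finset.sum_congr rfl fun x _ => Finset.sum_congr rfl fun y hy => ?_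
  have hy := Finset.HasAntidiagonal.mem_antidiagonal.1 hy
  simp only at h
  rw [hF (x.1, y.1) (by simp only; omega), hG (x.2, y.2) (by simp only; omega)]

theorem EqUpTo.refl (d : ℕ) (F : QP) : EqUpTo d F F := fun _ _ => rfl

theorem EqUpTo.qprodMul {d : ℕ} {F G : QP} (h : EqUpTo d F G) (γ : ℕ) (g : ℕ → QP) (a n : ℕ) :
    EqUpTo d (qprodMul γ g a n F) (qprodMul γ g a n G) := by
  induction n generalizing F G with
  | zero => exact h
  | succ n ih =>
    rw [qprodMul_succ, qprodMul_succ]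
    exact ih ((EqUpTo.refl d _).qmul h γ)

theorem EqUpTo.rowSeries_qmul {d k : ℕ} (h : d < k) (γ : ℕ) {f : K⟦X⟧}
    (hf : constantCoeff f = 1) (T : QP) : EqUpTo d (_root_.qmul γ (rowSeries γ k f) T) T := by
  have h1 : EqUpTo d (rowSeries γ k f) qone := by
    rintro ⟨m, n⟩ hn
    simp only at hn
    rcases Nat.eq_zero_or_pos m with rfl | hm
    · simp [rowSeries, ofSeries, qone, hf]
    · have h2 : n ≠ k * m := by
        have := Nat.le_mul_of_pos_right k hm
        omega
      simp [rowSeries, ofSeries, qone, h2, hm.ne']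
  have h2 := h1.qmul (EqUpTo.refl d T) γ
  rwa [qone_qmul] at h2

theorem EqUpTo.qprodMul_of_le {d γ : ℕ} {g : ℕ → QP} (a : ℕ)
    (hg : ∀ p, d < p → ∀ T, EqUpTo d (_root_.qmul γ (g p) T) T) {m n : ℕ} (hm : d ≤ m)
    (hmn : m ≤ n) (ha : 1 ≤ a) (T : QP) :
    EqUpTo d (_root_.qprodMul γ g a n T) (_root_.qprodMul γ g a m T) := by
  induction n, hmn using Nat.le_induction with
  | base => exact EqUpTo.refl _ _
  | succ n hn ih =>
    rw [qprodMul_succ]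
    exact fun p hp => ((hg (a + n) (by omega) T).qprodMul γ g a n p hp).trans (ih p hp)

end Truncation

section Telescoping

open PowerSeries

/-- The series of `Ψ_{v^c}(v^n·X)`. -/
def psiShift (c : ℕ) (n : ℤ) : K⟦X⟧ := rescale (v ^ n) (psiSeries (v ^ c))

theorem constantCoeff_psiShift (c : ℕ) (n : ℤ) : constantCoeff (psiShift c n) = 1 := by
  rw [psiShift, psiSeries, rescale_expSeries, constantCoeff_expSeries]

theorem psiShift_eq_mul {e : ℕ} (he : e ≠ 0) (n : ℤ) :
    psiShift e n = psiShift (2 * e) (n - e) * psiShift (2 * e) (n + e) := by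
  have hw : ∀ n : ℕ, n ≠ 0 → (v ^ e) ^ n ≠ 1 := fun n hn => by
    rw [← pow_mul]
    exact v_pow_ne_one (mul_ne_zero he hn)
  rw [psiShift, psiSeries_eq_mul (pow_ne_zero e v_ne_zero) hw, map_mul, rescale_rescale,
    rescale_rescale, ← pow_mul, mul_comm e 2, psiShift, psiShift, zpow_sub₀ v_ne_zero,
    zpow_add₀ v_ne_zero, zpow_natCast, div_eq_mul_inv, mul_comm (v ^ n), mul_comm (v ^ n)]

theorem psiShift_mul_eq {e : ℕ} (he : e ≠ 0) {ε : ℤ} (hε : ε = 1 ∨ ε = -1) (n : ℤ) :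
    psiShift (2 * e) n * psiShift (2 * e) (n + 2 * ε * e) = psiShift e (n + ε * e) := by
  rw [psiShift_eq_mul he]
  rcases hε with rfl | rfl
  · congr 2 <;> ring
  · rw [mul_comm]
    congr 2 <;> ring

theorem pentagon_qmul {γ : ℕ} (hγ : γ ≠ 0) (k : ℕ) (b c : ℤ) (T : QP) :
    qmul γ (colSeries (psiShift γ b)) (qmul γ (rowSeries γ k (psiShift γ c)) T) =
    qmul γ (rowSeries γ k (psiShift γ c)) (qmul γ (rowSeries γ (k + 1) (psiShift γ (c + b)))
      (qmul γ (colSeries (psiShift γ b)) T)) := by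
  have h := congrArg (fun F => qmul γ F T) (pentagon γ hγ k (v ^ b) (v ^ c))
  simp only [qmul_assoc] at h
  rw [psiShift, psiShift, h, psiShift, zpow_add₀ v_ne_zero]

theorem pentagon_qmul_two {e : ℕ} (he : e ≠ 0) (k : ℕ) (b c : ℤ) (T : QP) :
    qmul (2 * e) (colSeries (psiShift e b))
      (qmul (2 * e) (rowSeries (2 * e) k (psiShift (2 * e) c)) T) =
    qmul (2 * e) (rowSeries (2 * e) k (psiShift (2 * e) c))
      (qmul (2 * e) (rowSeries (2 * e) (k + 1) (psiShift e (c + b)))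
        (qmul (2 * e) (rowSeries (2 * e) (k + 2) (psiShift (2 * e) (c + 2 * b)))
          (qmul (2 * e) (colSeries (psiShift e b)) T))) := by
  have hγ : 2 * e ≠ 0 := by omega
  rw [psiShift_eq_mul he b, ← colSeries_mul (2 * e), qmul_assoc, pentagon_qmul hγ,
    pentagon_qmul hγ, pentagon_qmul hγ, psiShift_eq_mul he (c + b), ← rowSeries_mul,
    qmul_assoc, qmul_assoc]
  rw [show c + (b + (e : ℤ)) + (b - e) = c + 2 * b by ring, ← add_sub_assoc, ← add_assoc]

/-- The factors `Ψ_{v^{2e}}(v^{β+2pβ'+2pεe}·y^{(1,2p)})`. -/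
def evenFactor (e : ℕ) (β β' ε : ℤ) (p : ℕ) : QP :=
  rowSeries (2 * e) (2 * p) (psiShift (2 * e) (β + 2 * p * β' + 2 * p * ε * e))

/-- The factors `Ψ_{v^e}(v^{β+pβ'+(p-1)εe}·y^{(1,p)})`. -/
def fullFactor (e : ℕ) (β β' ε : ℤ) (p : ℕ) : QP :=
  rowSeries (2 * e) p (psiShift e (β + p * β' + (p - 1) * ε * e))

theorem telescope {e : ℕ} (he : e ≠ 0) (β β' : ℤ) {ε : ℤ} (hε : ε = 1 ∨ ε = -1) (N : ℕ) (T : QP) :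
    qmul (2 * e) (colSeries (psiShift e β')) (qprodMul (2 * e) (evenFactor e β β' ε) 0 (N + 1) T) =
    qmul (2 * e) (evenFactor e β β' ε 0)
      (qprodMul (2 * e) (fullFactor e β β' ε) 1 (2 * N + 1)
        (qmul (2 * e) (rowSeries (2 * e) (2 * N + 2)
          (psiShift (2 * e) (β + 2 * N * β' + 2 * N * ε * e + 2 * β')))
            (qmul (2 * e) (colSeries (psiShift e β')) T))) := by
  induction N generalizing T with
  | zero =>
    simp only [qprodMul, List.range'_one, List.map_cons, List.map_nil, List.foldr_cons,
      List.foldr_nil, Nat.mul_zero, Nat.zero_add]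
    rw [evenFactor, pentagon_qmul_two he, fullFactor]
    congr 3
    congr 1
    push_cast
    ring
  | succ N ih =>
    rw [qprodMul_succ, ih, show 2 * (N + 1) + 1 = 2 * N + 1 + 1 + 1 by ring,
      qprodMul_succ _ _ _ (2 * N + 1 + 1), qprodMul_succ _ _ _ (2 * N + 1), evenFactor, evenFactor,
      pentagon_qmul_two he]
    congr 2
    rw [← qmul_assoc, show 0 + (N + 1) = N + 1 by ring, show 2 * (N + 1) = 2 * N + 2 by ring,
      rowSeries_mul, fullFactor, fullFactor]
    congr 1
    · rw [show 1 + (2 * N + 1) = 2 * N + 2 by ring]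
      have h : β + 2 * ((N + 1 : ℕ) : ℤ) * β' + 2 * ((N + 1 : ℕ) : ℤ) * ε * e =
          β + 2 * N * β' + 2 * N * ε * e + 2 * β' + 2 * ε * e := by
        push_cast
        ring
      rw [h, psiShift_mul_eq he hε]
      congr 2
      push_cast
      ring
    · rw [show 1 + (2 * N + 1 + 1) = 2 * N + 2 + 1 by ring]
      congr 3
      push_cast
      ring

/-- The common limit of the two sides of the infinite pentagon identity. -/
theorem exists_limit {e : ℕ} (he : e ≠ 0) (β β' : ℤ) {ε : ℤ} (hε : ε = 1 ∨ ε = -1) :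
    ∃ L : QP,
      (∀ x, ∀ᶠ N in atTop, qmul (2 * e) (colSeries (psiShift e β'))
        (qprodR (2 * e) (evenFactor e β β' ε) 0 N) x = L x) ∧
      (∀ x, ∀ᶠ N in atTop, qmul (2 * e) (evenFactor e β β' ε 0)
        (qmul (2 * e) (qprodR (2 * e) (fullFactor e β β' ε) 1 N)
          (colSeries (psiShift e β'))) x = L x) := by
  set W := colSeries (psiShift e β')
  let S (N : ℕ) (T : QP) : QP := qmul (2 * e) (evenFactor e β β' ε 0)
    (qprodMul (2 * e) (fullFactor e β β' ε) 1 N T)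
  have hS {d m n : ℕ} (hm : d ≤ m) (hmn : m ≤ n) : EqUpTo d (S n W) (S m W) := by
    refine (EqUpTo.refl d _).qmul (EqUpTo.qprodMul_of_le 1 (fun p hp T => ?_) hm hmn le_rfl W) _
    exact EqUpTo.rowSeries_qmul hp _ (constantCoeff_psiShift _ _) T
  refine ⟨fun x => S x.2 W x, fun x => ?_, fun x => ?_⟩
  · filter_upwards [eventually_ge_atTop x.2] with N hN
    have h := telescope he β β' hε N qone
    rw [qmul_qone] at h
    refine (congrFun h x).trans (Eq.trans ?_ (hS le_rfl (show x.2 ≤ 2 * N + 1 by omega) x le_rfl))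
    refine (EqUpTo.refl x.2 _).qmul (EqUpTo.qprodMul ?_ _ _ _ _) _ x le_rfl
    exact EqUpTo.rowSeries_qmul (by omega) _ (constantCoeff_psiShift _ _) W
  · filter_upwards [eventually_ge_atTop x.2] with N hN
    refine Eq.trans ?_ (hS le_rfl hN x le_rfl)
    simp only [S, qprodMul]
    rw [foldr_qmul _ _ W]
    rfl

theorem qPsi_eq_evenFactor (e : ℕ) (β β' ε : ℤ) (p : ℕ) :
    qPsi (2 * e) (v ^ (2 * e))
      (qy (2 * e) (β + 2 * (p : ℤ) * β' + 2 * (p : ℤ) * ε * (e : ℤ)) 1 (2 * p)) =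
    evenFactor e β β' ε p :=
  qPsi_row _ _ _ _

theorem qPsi_eq_fullFactor (e : ℕ) (β β' ε : ℤ) (p : ℕ) :
    qPsi (2 * e) (v ^ e)
      (qy (2 * e) (β + (p : ℤ) * β' + ((p : ℤ) - 1) * ε * (e : ℤ)) 1 p) =
    fullFactor e β β' ε p :=
  qPsi_row _ _ _ _

theorem qPsi_eq_evenFactor_zero (e : ℕ) (β β' ε : ℤ) :
    qPsi (2 * e) (v ^ (2 * e)) (qy (2 * e) β 1 0) = evenFactor e β β' ε 0 := by
  rw [← qPsi_eq_evenFactor]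
  simp

theorem qPsi_eq_col (e : ℕ) (β' : ℤ) :
    qPsi (2 * e) (v ^ e) (qy (2 * e) β' 0 1) = colSeries (psiShift e β') :=
  qPsi_col _ _ _

end Telescoping

/-- Lemma A.3, quantum-plane form: in `A_{2e}`, for `ε = ±1`,
(i) `Ψ_{v^e}(v^{β'}Y₂)·→∏_{p≥0} Ψ_{v^{2e}}(v^{β+2pβ'+2pεe}y^{(1,2p)})
  = Ψ_{v^{2e}}(v^{β}Y₁)·(→∏_{p≥1} Ψ_{v^e}(v^{β+pβ'+(p−1)εe}y^{(1,p)}))·Ψ_{v^e}(v^{β'}Y₂)`, and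
(ii) `(←∏_{p≥0} Ψ_{v^{2e}}(v^{2pβ+β'+2pεe}y^{(2p,1)}))·Ψ_{v^e}(v^{β}Y₁)
  = Ψ_{v^e}(v^{β}Y₁)·(←∏_{p≥1} Ψ_{v^e}(v^{pβ+β'+(p−1)εe}y^{(p,1)}))·Ψ_{v^{2e}}(v^{β'}Y₂)`,
both sides understood as coefficientwise limits of the partial ordered products. -/
theorem lemma_A3 (e : ℕ) (he : 0 < e) (β β' ε : ℤ) (hε : ε = 1 ∨ ε = -1) :
    (∃ L : QP,
      (∀ x, ∀ᶠ N in atTop,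
        qmul (2 * e) (qPsi (2 * e) (v ^ e) (qy (2 * e) β' 0 1))
          (qprodR (2 * e)
            (fun p => qPsi (2 * e) (v ^ (2 * e))
              (qy (2 * e) (β + 2 * (p : ℤ) * β' + 2 * (p : ℤ) * ε * (e : ℤ)) 1 (2 * p))) 0 N) x
          = L x) ∧
      (∀ x, ∀ᶠ N in atTop,
        qmul (2 * e) (qPsi (2 * e) (v ^ (2 * e)) (qy (2 * e) β 1 0))
          (qmul (2 * e)
            (qprodR (2 * e)
              (fun p => qPsi (2 * e) (v ^ e)
                (qy (2 * e) (β + (p : ℤ) * β' + ((p : ℤ) - 1) * ε * (e : ℤ)) 1 p)) 1 N)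
            (qPsi (2 * e) (v ^ e) (qy (2 * e) β' 0 1))) x = L x))
    ∧
    (∃ L : QP,
      (∀ x, ∀ᶠ N in atTop,
        qmul (2 * e)
          (qprodL (2 * e)
            (fun p => qPsi (2 * e) (v ^ (2 * e))
              (qy (2 * e) (2 * (p : ℤ) * β + β' + 2 * (p : ℤ) * ε * (e : ℤ)) (2 * p) 1)) 0 N)
          (qPsi (2 * e) (v ^ e) (qy (2 * e) β 1 0)) x = L x) ∧
      (∀ x, ∀ᶠ N in atTop,
        qmul (2 * e) (qPsi (2 * e) (v ^ e) (qy (2 * e) β 1 0))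
          (qmul (2 * e)
            (qprodL (2 * e)
              (fun p => qPsi (2 * e) (v ^ e)
                (qy (2 * e) ((p : ℤ) * β + β' + ((p : ℤ) - 1) * ε * (e : ℤ)) p 1)) 1 N)
            (qPsi (2 * e) (v ^ (2 * e)) (qy (2 * e) β' 0 1))) x = L x)) := by
  have he' : e ≠ 0 := he.ne'
  constructor
  · simp only [qPsi_eq_evenFactor, qPsi_eq_fullFactor, qPsi_eq_evenFactor_zero e β β' ε,
      qPsi_eq_col]
    exact exists_limit he' β β' hε
  · obtain ⟨L, h1, h2⟩ := exists_limit he' β' β hε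
    have hE (p : ℕ) : qPsi (2 * e) (v ^ (2 * e))
        (qy (2 * e) (2 * (p : ℤ) * β + β' + 2 * (p : ℤ) * ε * (e : ℤ)) (2 * p) 1) =
        qswap (evenFactor e β' β ε p) := by
      rw [qy_eq_qswap, qPsi_qswap, ← qPsi_eq_evenFactor, add_comm (2 * (p : ℤ) * β)]
    have hF (p : ℕ) : qPsi (2 * e) (v ^ e)
        (qy (2 * e) ((p : ℤ) * β + β' + ((p : ℤ) - 1) * ε * (e : ℤ)) p 1) =
        qswap (fullFactor e β' β ε p) := by
      rw [qy_eq_qswap, qPsi_qswap, ← qPsi_eq_fullFactor, add_comm ((p : ℤ) * β)]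
    have hE0 : qPsi (2 * e) (v ^ (2 * e)) (qy (2 * e) β' 0 1) =
        qswap (evenFactor e β' β ε 0) := by
      rw [qy_eq_qswap, qPsi_qswap, ← qPsi_eq_evenFactor_zero]
    have hW : qPsi (2 * e) (v ^ e) (qy (2 * e) β 1 0) = qswap (colSeries (psiShift e β)) := by
      rw [qy_eq_qswap, qPsi_qswap, ← qPsi_eq_col]
    simp only [hE, hF, hE0, hW, qprodL_qswap, qmul_qswap, qmul_assoc]
    exact ⟨qswap L, fun x => h1 x.swap, fun x => h2 x.swap⟩
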